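/- arXiv:2605.26407 — 2 statements merged into one kernel-verified Lean document; each statement's English description precedes it below -/
import Mathlib

section
/- In the exterior algebra over ℚ of the vector space ℚ⁸ = (Fin 8 → ℚ), with x₁,y₁,…,x₄,y₄ the images of the standard basis vectors, ωᵢ = xᵢ·yᵢ, θ = ω₁+ω₂+ω₃+ω₄, and b = x₁·(y₁+y₃) + x₂·y₂ + x₃·y₁, call an element integral if it lies in the ℤ-submodule spanned by all finite products e_{i₁}·…·e_{iₖ} (i₁<⋯<iₖ) of the images of the standard basis vectors. Let m₁, m₂, m₃, m₄ ∈ ℚ and set P₁ = 2b + m₁θ, P₂ = (3/2)b² + (3/2)m₁·bθ + (1/2)m₂·θ², P₃ = (1/2)b³ + (3/4)m₁·b²θ + (1/2)m₂·bθ² + (1/6)m₃·θ³, P₄ = (1/16)b⁴ + (1/8)m₁·b³θ + (1/8)m₂·b²θ² + (1/12)m₃·bθ³ + (1/24)m₄·θ⁴. If P₁, P₂, P₃ and P₄ are all integral, then m₁ ∈ 2ℤ, m₂ ∈ ℤ, m₃ ∈ ℤ, and 2m₄ ∈ ℤ. -/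
noncomputable section

open ExteriorAlgebra

/-- The image of the `i`-th standard basis vector of `ℚ⁸` in the exterior algebra. -/
def e (i : Fin 8) : ExteriorAlgebra ℚ (Fin 8 → ℚ) :=
  ι ℚ (Pi.single i 1 : Fin 8 → ℚ)

def x₁ : ExteriorAlgebra ℚ (Fin 8 → ℚ) := e 0
def y₁ : ExteriorAlgebra ℚ (Fin 8 → ℚ) := e 1
def x₂ : ExteriorAlgebra ℚ (Fin 8 → ℚ) := e 2
def y₂ : ExteriorAlgebra ℚ (Fin 8 → ℚ) := e 3
def x₃ : ExteriorAlgebra ℚ (Fin 8 → ℚ) := e 4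
def y₃ : ExteriorAlgebra ℚ (Fin 8 → ℚ) := e 5
def x₄ : ExteriorAlgebra ℚ (Fin 8 → ℚ) := e 6
def y₄ : ExteriorAlgebra ℚ (Fin 8 → ℚ) := e 7

def ω₁ : ExteriorAlgebra ℚ (Fin 8 → ℚ) := x₁ * y₁
def ω₂ : ExteriorAlgebra ℚ (Fin 8 → ℚ) := x₂ * y₂
def ω₃ : ExteriorAlgebra ℚ (Fin 8 → ℚ) := x₃ * y₃
def ω₄ : ExteriorAlgebra ℚ (Fin 8 → ℚ) := x₄ * y₄

def θ : ExteriorAlgebra ℚ (Fin 8 → ℚ) := ω₁ + ω₂ + ω₃ + ω₄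

def b : ExteriorAlgebra ℚ (Fin 8 → ℚ) := x₁ * (y₁ + y₃) + x₂ * y₂ + x₃ * y₁

/-- The `ℤ`-lattice of integral classes: the `ℤ`-submodule spanned by all products
`e i₁ * ⋯ * e iₖ` with `i₁ < ⋯ < iₖ`. -/
def IntegralLattice : Submodule ℤ (ExteriorAlgebra ℚ (Fin 8 → ℚ)) :=
  Submodule.span ℤ
    {z | ∃ l : List (Fin 8), l.Chain' (· < ·) ∧ z = (l.map e).prod}

/-- The top-degree coefficient on the exterior algebra of `Rⁿ`, given by the determinant. -/
def detCoeff (R : Type*) [CommRing R] (n : ℕ) : ExteriorAlgebra R (Fin n → R) →ₗ[R] R :=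
  liftAlternating fun k =>
    if h : k = n then (Matrix.detRowAlternating (R := R) (n := Fin n)).domDomCongr (finCongr h.symm)
    else 0

theorem detCoeff_ιMulti {R : Type*} [CommRing R] {n : ℕ} (v : Fin n → Fin n → R) :
    detCoeff R n (ιMulti R n v) = (Matrix.of v).det := by
  rw [detCoeff, liftAlternating_apply_ιMulti, dif_pos rfl]
  rfl

theorem detCoeff_ιMulti_of_ne {R : Type*} [CommRing R] {n k : ℕ} (h : k ≠ n)
    (v : Fin k → Fin n → R) : detCoeff R n (ιMulti R k v) = 0 := by
  rw [detCoeff, liftAlternating_apply_ιMulti, dif_neg h, AlternatingMap.zero_apply]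

theorem detCoeff_ιMulti_single_mem {n k : ℕ} (f : Fin k → Fin n) :
    ∃ c : ℤ, detCoeff ℚ n (ιMulti ℚ k fun i => (Pi.single (f i) 1 : Fin n → ℚ)) = c := by
  by_cases h : k = n
  · subst h
    refine ⟨(Matrix.of fun i => (Pi.single (f i) 1 : Fin k → ℤ)).det, ?_⟩
    rw [detCoeff_ιMulti, Int.cast_det]
    congr 1
    ext i j
    simp [Pi.single_apply]
  · exact ⟨0, by rw [detCoeff_ιMulti_of_ne h, Int.cast_zero]⟩

theorem detCoeff_ιMulti_single (R : Type*) [CommRing R] (n : ℕ) :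
    detCoeff R n (ιMulti R n fun i => (Pi.single i 1 : Fin n → R)) = 1 := by
  have h : (Matrix.of fun i : Fin n => (Pi.single i 1 : Fin n → R)) = 1 := by
    ext i j
    simp [Matrix.one_apply, Pi.single_apply, eq_comm]
  rw [detCoeff_ιMulti, h, Matrix.det_one]

theorem list_map_e_prod (l : List (Fin 8)) :
    (l.map e).prod = ιMulti ℚ l.length fun i => (Pi.single (l.get i) 1 : Fin 8 → ℚ) := by
  rw [ιMulti_apply]
  congr 1
  conv_lhs => rw [← List.ofFn_get l]
  rw [List.map_ofFn]
  rfl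

theorem detCoeff_list_prod_mem (l : List (Fin 8)) :
    ∃ k : ℤ, detCoeff ℚ 8 (l.map e).prod = k := by
  rw [list_map_e_prod]
  exact detCoeff_ιMulti_single_mem _

theorem detCoeff_mul_list_prod_mem {z : ExteriorAlgebra ℚ (Fin 8 → ℚ)} (hz : z ∈ IntegralLattice)
    (l : List (Fin 8)) : ∃ k : ℤ, detCoeff ℚ 8 (z * (l.map e).prod) = k := by
  refine Submodule.span_induction ?_ ⟨0, by simp⟩ ?_ ?_ hz
  · rintro _ ⟨l', -, rfl⟩
    rw [← List.prod_append, ← List.map_append]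
    exact detCoeff_list_prod_mem _
  · rintro u v - - ⟨k, hk⟩ ⟨k', hk'⟩
    exact ⟨k + k', by rw [add_mul, map_add, hk, hk', Int.cast_add]⟩
  · rintro n u - ⟨k, hk⟩
    exact ⟨n * k, by rw [smul_mul_assoc, map_zsmul, hk, zsmul_eq_mul, Int.cast_mul]⟩

theorem detCoeff_volume : detCoeff ℚ 8 (ω₁ * ω₂ * ω₃ * ω₄) = 1 := by
  have h : ω₁ * ω₂ * ω₃ * ω₄ = ((List.finRange 8).map e).prod := by
    simp [ω₁, ω₂, ω₃, ω₄, x₁, y₁, x₂, y₂, x₃, y₃, x₄, y₄, List.finRange_succ, mul_assoc]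
  have h' : ((List.finRange 8).map e).prod =
      ιMulti ℚ 8 fun i => (Pi.single i 1 : Fin 8 → ℚ) := by
    rw [ιMulti_apply, List.ofFn_eq_map]
    rfl
  rw [h, h', detCoeff_ιMulti_single]

section TwoForms

variable {R M : Type*} [CommRing R] [AddCommGroup M] [Module R M]

theorem ι_mul_ι_comm (u v : M) : ι R u * ι R v = -(ι R v * ι R u) :=
  eq_neg_of_add_eq_zero_left (ι_add_mul_swap u v)

theorem commute_ι_mul_ι_ι (u v w : M) : Commute (ι R u * ι R v) (ι R w) := by
  rw [Commute, SemiconjBy, mul_assoc, ι_mul_ι_comm v w, mul_neg, ← mul_assoc, ι_mul_ι_comm u w,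
    neg_mul, neg_neg, mul_assoc]

theorem commute_ι_mul_ι (u v w z : M) : Commute (ι R u * ι R v) (ι R w * ι R z) :=
  (commute_ι_mul_ι_ι u v w).mul_right (commute_ι_mul_ι_ι u v z)

theorem ι_mul_ι_mul_same_left (u v w : M) : ι R u * ι R v * (ι R u * ι R w) = 0 := by
  rw [← mul_assoc, (commute_ι_mul_ι_ι u v u).eq, ← mul_assoc, ι_sq_zero, zero_mul, zero_mul]

theorem ι_mul_ι_mul_same_right (u v w : M) : ι R u * ι R v * (ι R w * ι R v) = 0 := by
  rw [mul_assoc, ← (commute_ι_mul_ι_ι w v v).eq, mul_assoc, ι_sq_zero, mul_zero, mul_zero]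

theorem ι_mul_ι_mul_swap (u v w z : M) :
    ι R u * ι R v * (ι R w * ι R z) = -(ι R u * ι R z * (ι R w * ι R v)) := by
  rw [mul_assoc, mul_assoc, ← (commute_ι_mul_ι_ι w z v).eq, ← (commute_ι_mul_ι_ι w v z).eq,
    mul_assoc, mul_assoc, ι_mul_ι_comm z v, mul_neg, mul_neg]

end TwoForms

/-- The evaluations in top degree of the monomials in `b` and `θ`, derived from the multiplication
table of the two-forms `ωᵢ`, `s = x₁ * y₃` and `t = x₃ * y₁`. -/
theorem monomials_of_relations {A : Type*} [CommRing A] {w₁ w₂ w₃ w₄ s t β τ : A}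
    (h₁ : w₁ * w₁ = 0) (h₂ : w₂ * w₂ = 0) (h₃ : w₃ * w₃ = 0) (h₄ : w₄ * w₄ = 0)
    (hs : s * s = 0) (ht : t * t = 0) (h₁s : w₁ * s = 0) (h₁t : w₁ * t = 0)
    (h₃s : w₃ * s = 0) (h₃t : w₃ * t = 0) (hst : s * t = -(w₁ * w₃))
    (hβ : β = w₁ + s + w₂ + t) (hτ : τ = w₁ + w₂ + w₃ + w₄) :
    (β * (w₁ * w₂ * w₃) = 0 ∧ τ * (w₁ * w₂ * w₃) = w₁ * w₂ * w₃ * w₄) ∧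
    (β * β * (w₂ * t) = 0 ∧ β * τ * (w₂ * t) = -(w₁ * w₂ * w₃ * w₄) ∧ τ * τ * (w₂ * t) = 0) ∧
    (β * β * (w₁ * w₂) = 0 ∧ β * τ * (w₁ * w₂) = 0 ∧
      τ * τ * (w₁ * w₂) = 2 * (w₁ * w₂ * w₃ * w₄)) ∧
    (β * β * β * w₁ = 0 ∧ β * β * τ * w₁ = 0 ∧ β * τ * τ * w₁ = 2 * (w₁ * w₂ * w₃ * w₄) ∧
      τ * τ * τ * w₁ = 6 * (w₁ * w₂ * w₃ * w₄)) ∧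
    (β * β * β * β = 0 ∧ β * β * β * τ = -6 * (w₁ * w₂ * w₃ * w₄) ∧ β * β * τ * τ = 0 ∧
      β * τ * τ * τ = 12 * (w₁ * w₂ * w₃ * w₄) ∧
      τ * τ * τ * τ = 24 * (w₁ * w₂ * w₃ * w₄)) := by
  subst hβ hτ
  refine ⟨⟨?_, ?_⟩, ⟨?_, ?_, ?_⟩, ⟨?_, ?_, ?_⟩, ⟨?_, ?_, ?_, ?_⟩, ⟨?_, ?_, ?_, ?_, ?_⟩⟩ <;> grind

open scoped IsMulCommutative in
/-- The evaluations in top degree of the monomials in `b` and `θ`. -/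
theorem monomials_b_θ :
    (b * (ω₁ * ω₂ * ω₃) = 0 ∧ θ * (ω₁ * ω₂ * ω₃) = ω₁ * ω₂ * ω₃ * ω₄) ∧
    (b * b * (ω₂ * (x₃ * y₁)) = 0 ∧ b * θ * (ω₂ * (x₃ * y₁)) = -(ω₁ * ω₂ * ω₃ * ω₄) ∧
      θ * θ * (ω₂ * (x₃ * y₁)) = 0) ∧
    (b * b * (ω₁ * ω₂) = 0 ∧ b * θ * (ω₁ * ω₂) = 0 ∧
      θ * θ * (ω₁ * ω₂) = 2 * (ω₁ * ω₂ * ω₃ * ω₄)) ∧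
    (b * b * b * ω₁ = 0 ∧ b * b * θ * ω₁ = 0 ∧ b * θ * θ * ω₁ = 2 * (ω₁ * ω₂ * ω₃ * ω₄) ∧
      θ * θ * θ * ω₁ = 6 * (ω₁ * ω₂ * ω₃ * ω₄)) ∧
    (b * b * b * b = 0 ∧ b * b * b * θ = -6 * (ω₁ * ω₂ * ω₃ * ω₄) ∧ b * b * θ * θ = 0 ∧
      b * θ * θ * θ = 12 * (ω₁ * ω₂ * ω₃ * ω₄) ∧
      θ * θ * θ * θ = 24 * (ω₁ * ω₂ * ω₃ * ω₄)) := by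
  let S : Set (ExteriorAlgebra ℚ (Fin 8 → ℚ)) := {z | ∃ u v, z = ι ℚ u * ι ℚ v}
  have hS : ∀ z ∈ S, ∀ z' ∈ S, z * z' = z' * z := by
    rintro _ ⟨u, v, rfl⟩ _ ⟨u', v', rfl⟩
    exact commute_ι_mul_ι u v u' v'
  have : IsMulCommutative (Algebra.adjoin ℚ S) := Algebra.isMulCommutative_adjoin ℚ hS
  let twoForm (i j : Fin 8) : Algebra.adjoin ℚ S :=
    ⟨e i * e j, Algebra.subset_adjoin ⟨_, _, rfl⟩⟩
  have left (i j k : Fin 8) : twoForm i j * twoForm i k = 0 :=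
    Subtype.ext (ι_mul_ι_mul_same_left _ _ _)
  have right (i j k : Fin 8) : twoForm i j * twoForm k j = 0 :=
    Subtype.ext (ι_mul_ι_mul_same_right _ _ _)
  have swap (i j k l : Fin 8) : twoForm i j * twoForm k l = -(twoForm i l * twoForm k j) :=
    Subtype.ext (ι_mul_ι_mul_swap _ _ _ _)
  have key := monomials_of_relations (A := Algebra.adjoin ℚ S)
    (left 0 1 1) (left 2 3 3) (left 4 5 5) (left 6 7 7) (left 0 5 5) (left 4 1 1)
    (left 0 1 5) (right 0 1 4) (right 4 5 0) (left 4 5 1)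
    (swap 0 5 4 1) rfl rfl
  have hb : b = e 0 * e 1 + e 0 * e 5 + e 2 * e 3 + e 4 * e 1 := by
    simp only [b, x₁, y₁, x₂, y₂, x₃, y₃, mul_add]
  rw [hb]
  simp only [Subtype.ext_iff] at key
  exact key

theorem stmt_12 (m₁ m₂ m₃ m₄ : ℚ)
    (h₁ : (2 : ℚ) • b + m₁ • θ ∈ IntegralLattice)
    (h₂ : (3/2 : ℚ) • (b * b) + ((3/2) * m₁ : ℚ) • (b * θ) + ((1/2) * m₂ : ℚ) • (θ * θ)
      ∈ IntegralLattice)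
    (h₃ : (1/2 : ℚ) • (b * b * b) + ((3/4) * m₁ : ℚ) • (b * b * θ)
        + ((1/2) * m₂ : ℚ) • (b * θ * θ) + ((1/6) * m₃ : ℚ) • (θ * θ * θ)
      ∈ IntegralLattice)
    (h₄ : (1/16 : ℚ) • (b * b * b * b) + ((1/8) * m₁ : ℚ) • (b * b * b * θ)
        + ((1/8) * m₂ : ℚ) • (b * b * θ * θ) + ((1/12) * m₃ : ℚ) • (b * θ * θ * θ)
        + ((1/24) * m₄ : ℚ) • (θ * θ * θ * θ)
      ∈ IntegralLattice) :
    (∃ k : ℤ, m₁ = 2 * k) ∧ (∃ k : ℤ, m₂ = k) ∧ (∃ k : ℤ, m₃ = k) ∧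
      (∃ k : ℤ, 2 * m₄ = k) := by
  obtain ⟨⟨b₁, t₁⟩, ⟨bb₂, bt₂, tt₂⟩, ⟨bb₂', bt₂', tt₂'⟩, ⟨bbb₃, bbt₃, btt₃, ttt₃⟩,
    bbbb, bbbt, bbtt, bttt, tttt⟩ := monomials_b_θ
  have l₁ : (([0, 1, 2, 3, 4, 5] : List (Fin 8)).map e).prod = ω₁ * ω₂ * ω₃ := by
    simp [ω₁, ω₂, ω₃, x₁, y₁, x₂, y₂, x₃, y₃, mul_assoc]
  have l₂ : (([2, 3, 4, 1] : List (Fin 8)).map e).prod = ω₂ * (x₃ * y₁) := by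
    simp [ω₂, x₂, y₂, x₃, y₁, mul_assoc]
  have l₂' : (([0, 1, 2, 3] : List (Fin 8)).map e).prod = ω₁ * ω₂ := by
    simp [ω₁, ω₂, x₁, y₁, x₂, y₂, mul_assoc]
  have l₃ : (([0, 1] : List (Fin 8)).map e).prod = ω₁ := by
    simp [ω₁, x₁, y₁]
  have top_natCast_mul (n : ℕ) : detCoeff ℚ 8 ((n : ExteriorAlgebra ℚ (Fin 8 → ℚ)) *
      (ω₁ * ω₂ * ω₃ * ω₄)) = n := by
    rw [← nsmul_eq_mul, map_nsmul, detCoeff_volume, nsmul_one]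
  have top₂ := top_natCast_mul 2
  have top₆ := top_natCast_mul 6
  have top₁₂ := top_natCast_mul 12
  have top₂₄ := top_natCast_mul 24
  push_cast at top₂ top₆ top₁₂ top₂₄
  obtain ⟨k₁, hk₁⟩ := detCoeff_mul_list_prod_mem h₁ [0, 1, 2, 3, 4, 5]
  obtain ⟨k₂, hk₂⟩ := detCoeff_mul_list_prod_mem h₂ [2, 3, 4, 1]
  obtain ⟨k₂', hk₂'⟩ := detCoeff_mul_list_prod_mem h₂ [0, 1, 2, 3]
  obtain ⟨k₃, hk₃⟩ := detCoeff_mul_list_prod_mem h₃ [0, 1]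
  obtain ⟨k₄, hk₄⟩ := detCoeff_mul_list_prod_mem h₄ []
  simp only [l₁, add_mul, smul_mul_assoc, b₁, t₁, map_add, map_smul, map_zero, detCoeff_volume,
    smul_eq_mul] at hk₁
  simp only [l₂, add_mul, smul_mul_assoc, bb₂, bt₂, tt₂, map_add, map_smul, map_neg, map_zero,
    detCoeff_volume, smul_eq_mul] at hk₂
  simp only [l₂', add_mul, smul_mul_assoc, bb₂', bt₂', tt₂', map_add, map_smul, map_zero, top₂,
    smul_eq_mul] at hk₂'
  simp only [l₃, add_mul, smul_mul_assoc, bbb₃, bbt₃, btt₃, ttt₃, map_add, map_smul, map_zero,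
    top₂, top₆, smul_eq_mul] at hk₃
  simp only [List.map_nil, List.prod_nil, mul_one, bbbb, bbbt, bbtt, bttt, tttt, map_add, map_smul,
    map_neg, map_zero, neg_mul, top₆, top₁₂, top₂₄, smul_eq_mul] at hk₄
  refine ⟨⟨-k₂ - k₁, by push_cast; linarith⟩, ⟨k₂', by linarith⟩,
    ⟨k₃ - k₂', by push_cast; linarith⟩,
    ⟨2 * k₄ + 3 * (-k₂ - k₁) - 2 * (k₃ - k₂'), by push_cast; linarith⟩⟩

end
end

section
/- In the exterior algebra over ℚ of ℚ⁸ = (Fin 8 → ℚ), with x₁,y₁,…,x₄,y₄ the images of the standard basis vectors, ωᵢ = xᵢ·yᵢ, θ = ω₁+ω₂+ω₃+ω₄, b = x₁·(y₁+y₃) + x₂·y₂ + x₃·y₁, and 'integral' meaning membership in the ℤ-submodule spanned by all finite products of the images of the standard basis vectors: there do NOT exist m₁, m₂, m₃, m₄ ∈ ℚ such that the five elements P₁ = 2b + m₁θ, P₂ = (3/2)b² + (3/2)m₁·bθ + (1/2)m₂·θ², P₃ = (1/2)b³ + (3/4)m₁·b²θ + (1/2)m₂·bθ² + (1/6)m₃·θ³,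 P₄ = (1/16)b⁴ + (1/8)m₁·b³θ + (1/8)m₂·b²θ² + (1/12)m₃·bθ³ + (1/24)m₄·θ⁴, and (1/2)·P₃ are all integral. -/
noncomputable section

open ExteriorAlgebra

/-- The coefficient of `e (s 0) * ⋯ * e (s (k - 1))`, as a linear functional. -/
def monomialCoeff {k : ℕ} (s : Fin k → Fin 8) : ExteriorAlgebra ℚ (Fin 8 → ℚ) →ₗ[ℚ] ℚ :=
  liftAlternating (Pi.single k (Matrix.detRowAlternating.compLinearMap (LinearMap.funLeft ℚ ℚ s)))

theorem monomialCoeff_prod_ofFn {k : ℕ} (s t : Fin k → Fin 8) :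
    monomialCoeff s (List.ofFn fun i => e (t i)).prod =
      (Matrix.of fun i j => if s j = t i then (1 : ℚ) else 0).det := by
  have h : (List.ofFn fun i => e (t i)).prod =
      ιMulti ℚ k (fun i => (Pi.single (t i) 1 : Fin 8 → ℚ)) := by
    rw [ιMulti_apply]; rfl
  rw [h, monomialCoeff, liftAlternating_apply_ιMulti, Pi.single_eq_same]
  change Matrix.det _ = _
  congr 1
  ext i j
  simp [LinearMap.funLeft_apply, Pi.single_apply]

theorem monomialCoeff_prod_ofFn_self {k : ℕ} {s : Fin k → Fin 8} (hs : Function.Injective s) :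
    monomialCoeff s (List.ofFn fun i => e (s i)).prod = 1 := by
  rw [monomialCoeff_prod_ofFn, ← Matrix.det_one (n := Fin k)]
  congr 1
  ext i j
  simp [Matrix.one_apply, hs.eq_iff, eq_comm]

theorem monomialCoeff_prod_ofFn_eq_zero {k : ℕ} {s t : Fin k → Fin 8} (j : Fin k)
    (hj : ∀ i, s j ≠ t i) : monomialCoeff s (List.ofFn fun i => e (t i)).prod = 0 := by
  rw [monomialCoeff_prod_ofFn]
  exact Matrix.det_eq_zero_of_column_eq_zero j fun i => by simp [hj i]

theorem monomialCoeff_prod_map_mem_range {k : ℕ} (s : Fin k → Fin 8) (l : List (Fin 8)) :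
    monomialCoeff s (l.map e).prod ∈ (Int.castAddHom ℚ).range := by
  obtain ⟨n, t, rfl⟩ : ∃ (n : ℕ) (t : Fin n → Fin 8), l = List.ofFn t :=
    ⟨l.length, l.get, (List.ofFn_get l).symm⟩
  rw [List.map_ofFn]
  by_cases hn : n = k
  · subst hn
    refine ⟨(Matrix.of fun i j => if s j = t i then (1 : ℤ) else 0).det, ?_⟩
    refine Eq.trans ?_ (monomialCoeff_prod_ofFn s t).symm
    rw [Int.coe_castAddHom]
    beta_reduce
    rw [Int.cast_det]
    congr 1
    ext i j
    simp
  · have h : (List.ofFn (e ∘ t)).prod =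
        ιMulti ℚ n (fun i => (Pi.single (t i) 1 : Fin 8 → ℚ)) := by
      rw [ιMulti_apply]; rfl
    rw [h, monomialCoeff, liftAlternating_apply_ιMulti, Pi.single_eq_of_ne hn]
    exact zero_mem _

theorem monomialCoeff_mem_range {k : ℕ} (s : Fin k → Fin 8)
    {z : ExteriorAlgebra ℚ (Fin 8 → ℚ)} (hz : z ∈ IntegralLattice) :
    monomialCoeff s z ∈ (Int.castAddHom ℚ).range := by
  induction hz using Submodule.span_induction with
  | mem z hz =>
    obtain ⟨l, -, rfl⟩ := hz
    exact monomialCoeff_prod_map_mem_range s l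
  | zero => rw [map_zero]; exact zero_mem _
  | add z w _ _ hz hw => rw [map_add]; exact add_mem hz hw
  | smul n z _ hz => rw [map_zsmul]; exact zsmul_mem hz n

theorem ι_mul_ι_swap {R M : Type*} [CommRing R] [AddCommGroup M] [Module R M] (v w : M) :
    ι R v * ι R w = -(ι R w * ι R v) :=
  eq_neg_of_add_eq_zero_left (ι_add_mul_swap v w)

theorem ι_mul_ι_mem_center {R M : Type*} [CommRing R] [AddCommGroup M] [Module R M] (v w : M) :
    ι R v * ι R w ∈ Subalgebra.center R (ExteriorAlgebra R M) := by
  rw [Subalgebra.mem_center_iff]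
  intro z
  induction z using ExteriorAlgebra.induction with
  | algebraMap r => exact Algebra.commutes r _
  | ι u =>
    rw [← mul_assoc, ι_mul_ι_swap u v, neg_mul, mul_assoc, ι_mul_ι_swap u w, mul_neg, neg_neg,
      mul_assoc]
  | mul a c ha hc => rw [mul_assoc, hc, ← mul_assoc, ha, mul_assoc]
  | add a c ha hc => rw [add_mul, mul_add, ha, hc]

/-- The product `e i * e j` as an element of the (commutative) center. -/
def centralProd (i j : Fin 8) : Subalgebra.center ℚ (ExteriorAlgebra ℚ (Fin 8 → ℚ)) :=
  ⟨e i * e j, ι_mul_ι_mem_center _ _⟩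

theorem e_mul_e_swap (i j : Fin 8) : e i * e j = -(e j * e i) := ι_mul_ι_swap _ _

theorem e_mul_self (i : Fin 8) : e i * e i = 0 := ι_sq_zero _

theorem centralProd_mul_centralProd_swap (i j k l : Fin 8) :
    centralProd i j * centralProd k l = -(centralProd i l * centralProd k j) := by
  apply Subtype.ext
  change e i * e j * (e k * e l) = -(e i * e l * (e k * e j))
  calc e i * e j * (e k * e l) = e i * (e j * e k) * e l := by simp only [mul_assoc]
    _ = -(e i * (e k * (e j * e l))) := by rw [e_mul_e_swap j k]; simp [mul_assoc]
    _ = e i * (e k * e l) * e j := by rw [e_mul_e_swap j l]; simp [mul_assoc]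
    _ = -(e i * e l * (e k * e j)) := by rw [e_mul_e_swap k l]; simp [mul_assoc]

theorem centralProd_mul_same_left (i j k : Fin 8) : centralProd i j * centralProd i k = 0 := by
  apply Subtype.ext
  change e i * e j * (e i * e k) = 0
  rw [e_mul_e_swap i j, neg_mul, mul_assoc, ← mul_assoc (e i), e_mul_self]
  simp

theorem centralProd_mul_same_right (i j k : Fin 8) : centralProd i j * centralProd k j = 0 := by
  rw [centralProd_mul_centralProd_swap]
  apply Subtype.ext
  change -(e i * e j * (e k * e j)) = 0
  rw [e_mul_e_swap k j, mul_neg, neg_neg, mul_assoc, ← mul_assoc (e j), e_mul_self]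
  simp

/-- Expansion of the half of `P₃` in a commutative algebra, where `a i` plays the role of `ωᵢ`,
and `u`, `v` those of `x₁ * y₃`, `x₃ * y₁`. -/
theorem half_cubic_expansion {C : Type*} [CommRing C] [Algebra ℚ C] {a₁ a₂ a₃ a₄ u v : C}
    (h₁ : a₁ * a₁ = 0) (h₂ : a₂ * a₂ = 0) (h₃ : a₃ * a₃ = 0) (h₄ : a₄ * a₄ = 0)
    (hu : u * u = 0) (hv : v * v = 0) (hu₁ : u * a₁ = 0) (hu₃ : u * a₃ = 0)
    (hv₁ : v * a₁ = 0) (hv₃ : v * a₃ = 0) (huv : u * v = -(a₁ * a₃)) {β τ : C}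
    (hβ : β = a₁ + u + a₂ + v) (hτ : τ = a₁ + a₂ + a₃ + a₄) (m₁ m₂ m₃ : ℚ) :
    (1/2 : ℚ) • ((1/2 : ℚ) • (β * β * β) + ((3/4) * m₁ : ℚ) • (β * β * τ)
        + ((1/2) * m₂ : ℚ) • (β * τ * τ) + ((1/6) * m₃ : ℚ) • (τ * τ * τ)) =
      (-3/2 + m₂ + m₃ / 2 : ℚ) • (a₁ * a₂ * a₃) +
      (3/4 * m₁ + m₂ + m₃ / 2 : ℚ) • (a₁ * a₂ * a₄) +
      (-3/4 * m₁ + m₂ / 2 + m₃ / 2 : ℚ) • (a₁ * a₃ * a₄) +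
      (m₂ / 2 + m₃ / 2 : ℚ) • (a₂ * a₃ * a₄) +
      (3/4 * m₁ + m₂ / 2 : ℚ) • (u * a₂ * a₄ + v * a₂ * a₄) := by
  have hbbb : β * β * β = (-6 : ℚ) • (a₁ * a₂ * a₃) := by
    subst hβ hτ
    simp only [Algebra.smul_def, map_neg, map_ofNat]
    grind
  have hbbt : β * β * τ =
      (2 : ℚ) • (a₁ * a₂ * a₄ - a₁ * a₃ * a₄ + (u * a₂ * a₄ + v * a₂ * a₄)) := by
    subst hβ hτ
    simp only [Algebra.smul_def, map_ofNat]
    grind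
  have hbtt : β * τ * τ = (2 : ℚ) • ((2 : ℚ) • (a₁ * a₂ * a₃) + (2 : ℚ) • (a₁ * a₂ * a₄) +
      a₁ * a₃ * a₄ + a₂ * a₃ * a₄ + (u * a₂ * a₄ + v * a₂ * a₄)) := by
    subst hβ hτ
    simp only [Algebra.smul_def, map_ofNat]
    grind
  have httt : τ * τ * τ =
      (6 : ℚ) • (a₁ * a₂ * a₃ + a₁ * a₂ * a₄ + a₁ * a₃ * a₄ + a₂ * a₃ * a₄) := by
    subst hβ hτ
    simp only [Algebra.smul_def, map_ofNat]
    grind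
  rw [hbbb, hbbt, hbtt, httt]
  module

theorem half_cubic_eq (m₁ m₂ m₃ : ℚ) :
    (1/2 : ℚ) • ((1/2 : ℚ) • (b * b * b) + ((3/4) * m₁ : ℚ) • (b * b * θ)
        + ((1/2) * m₂ : ℚ) • (b * θ * θ) + ((1/6) * m₃ : ℚ) • (θ * θ * θ)) =
      (-3/2 + m₂ + m₃ / 2 : ℚ) • (List.ofFn fun i => e (![0, 1, 2, 3, 4, 5] i)).prod +
      (3/4 * m₁ + m₂ + m₃ / 2 : ℚ) • (List.ofFn fun i => e (![0, 1, 2, 3, 6, 7] i)).prod +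
      (-3/4 * m₁ + m₂ / 2 + m₃ / 2 : ℚ) •
        (List.ofFn fun i => e (![0, 1, 4, 5, 6, 7] i)).prod +
      (m₂ / 2 + m₃ / 2 : ℚ) • (List.ofFn fun i => e (![2, 3, 4, 5, 6, 7] i)).prod +
      (3/4 * m₁ + m₂ / 2 : ℚ) • ((List.ofFn fun i => e (![0, 5, 2, 3, 6, 7] i)).prod +
        (List.ofFn fun i => e (![4, 1, 2, 3, 6, 7] i)).prod) := by
  have hb : b = e 0 * e 1 + e 0 * e 5 + e 2 * e 3 + e 4 * e 1 := by
    rw [b, mul_add]; rfl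
  have h := congrArg Subtype.val <| half_cubic_expansion
    (a₁ := centralProd 0 1) (a₂ := centralProd 2 3) (a₃ := centralProd 4 5)
    (a₄ := centralProd 6 7) (u := centralProd 0 5) (v := centralProd 4 1)
    (centralProd_mul_same_left _ _ _) (centralProd_mul_same_left _ _ _)
    (centralProd_mul_same_left _ _ _) (centralProd_mul_same_left _ _ _)
    (centralProd_mul_same_left _ _ _) (centralProd_mul_same_left _ _ _)
    (centralProd_mul_same_left _ _ _) (centralProd_mul_same_right _ _ _)
    (centralProd_mul_same_right _ _ _) (centralProd_mul_same_left _ _ _)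
    (centralProd_mul_centralProd_swap _ _ _ _) rfl rfl m₁ m₂ m₃
  rw [hb]
  simpa [centralProd, List.ofFn_succ, mul_assoc, θ, ω₁, ω₂, ω₃, ω₄, x₁, x₂, x₃, x₄,
    y₁, y₂, y₃, y₄] using h

theorem stmt_14 :
    ¬ ∃ m₁ m₂ m₃ m₄ : ℚ,
      (2 : ℚ) • b + m₁ • θ ∈ IntegralLattice ∧
      (3/2 : ℚ) • (b * b) + ((3/2) * m₁ : ℚ) • (b * θ) + ((1/2) * m₂ : ℚ) • (θ * θ)
        ∈ IntegralLattice ∧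
      (1/2 : ℚ) • (b * b * b) + ((3/4) * m₁ : ℚ) • (b * b * θ)
          + ((1/2) * m₂ : ℚ) • (b * θ * θ) + ((1/6) * m₃ : ℚ) • (θ * θ * θ)
        ∈ IntegralLattice ∧
      (1/16 : ℚ) • (b * b * b * b) + ((1/8) * m₁ : ℚ) • (b * b * b * θ)
          + ((1/8) * m₂ : ℚ) • (b * b * θ * θ) + ((1/12) * m₃ : ℚ) • (b * θ * θ * θ)
          + ((1/24) * m₄ : ℚ) • (θ * θ * θ * θ)
        ∈ IntegralLattice ∧
      (1/2 : ℚ) • ((1/2 : ℚ) • (b * b * b) + ((3/4) * m₁ : ℚ) • (b * b * θ)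
          + ((1/2) * m₂ : ℚ) • (b * θ * θ) + ((1/6) * m₃ : ℚ) • (θ * θ * θ))
        ∈ IntegralLattice := by
  rintro ⟨m₁, m₂, m₃, -, -, -, -, -, h⟩
  rw [half_cubic_eq] at h
  obtain ⟨p, hp⟩ := monomialCoeff_mem_range ![0, 1, 2, 3, 4, 5] h
  obtain ⟨q, hq⟩ := monomialCoeff_mem_range ![0, 1, 4, 5, 6, 7] h
  obtain ⟨r, hr⟩ := monomialCoeff_mem_range ![0, 5, 2, 3, 6, 7] h
  simp only [map_add, map_smul, smul_eq_mul, Int.coe_castAddHom] at hp hq hr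
  rw [monomialCoeff_prod_ofFn_self (by decide),
    monomialCoeff_prod_ofFn_eq_zero 4 (by decide),
    monomialCoeff_prod_ofFn_eq_zero 2 (by decide),
    monomialCoeff_prod_ofFn_eq_zero 0 (by decide),
    monomialCoeff_prod_ofFn_eq_zero 1 (by decide),
    monomialCoeff_prod_ofFn_eq_zero 0 (by decide)] at hp
  rw [monomialCoeff_prod_ofFn_eq_zero 4 (by decide),
    monomialCoeff_prod_ofFn_eq_zero 2 (by decide),
    monomialCoeff_prod_ofFn_self (by decide),
    monomialCoeff_prod_ofFn_eq_zero 0 (by decide),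
    monomialCoeff_prod_ofFn_eq_zero 1 (by decide),
    monomialCoeff_prod_ofFn_eq_zero 0 (by decide)] at hq
  rw [monomialCoeff_prod_ofFn_eq_zero 4 (by decide),
    monomialCoeff_prod_ofFn_eq_zero 1 (by decide),
    monomialCoeff_prod_ofFn_eq_zero 2 (by decide),
    monomialCoeff_prod_ofFn_eq_zero 0 (by decide),
    monomialCoeff_prod_ofFn_self (by decide),
    monomialCoeff_prod_ofFn_eq_zero 0 (by decide)] at hr
  have h2 : (2 * (p - q - r) : ℚ) = -3 := by linear_combination 2 * hp - 2 * hq - 2 * hr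
  have h3 : 2 * (p - q - r) = -3 := by exact_mod_cast h2
  omega

end
end
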